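/- arXiv:2008.05679 — 2 statements merged into one kernel-verified Lean document; each statement's English description precedes it below -/
import Mathlib

section
/- (Lasota–Yorke inequality for S^∞.) Assume there exist B₃>0, C₂>0 and 0<β₂<1 such that for every ζ-Hölder g : M → ℝ and every n ≥ 1, |P_f^n g|_ζ ≤ B₃·β₂^n·|g|_ζ + C₂·sup|g| (for suitable ζ-Hölder versions of P_f^n g). Then there exist A>0, B₂>0 and 0<λ<1 such that for all μ ∈ S^∞ and all n ≥ 1: ‖F_*^n μ‖_{S^∞} ≤ A·λ^n·‖μ‖_{S^∞} + B₂·‖μ‖_∞. -/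
open MeasureTheory ProbabilityTheory Filter ENNReal

section Setting

variable {M : Type*} {K : Type*}
variable [MetricSpace M] [CompactSpace M] [MeasurableSpace M] [BorelSpace M]
variable [MetricSpace K] [CompactSpace K] [MeasurableSpace K] [BorelSpace K]
variable [StandardBorelSpace K] [Nonempty K]

/-- Integral of a function against a signed measure, via the Jordan decomposition. -/
noncomputable def sInt {X : Type*} [MeasurableSpace X] (μ : SignedMeasure X) (g : X → ℝ) : ℝ :=
  ∫ x, g x ∂μ.toJordanDecomposition.posPart - ∫ x, g x ∂μ.toJordanDecomposition.negPart

/-- The Wasserstein–Kantorovich-like norm `‖μ‖_W` on signed measures on `K`. -/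
noncomputable def wNorm {X : Type*} [MetricSpace X] [MeasurableSpace X] (ζ : ℝ)
    (μ : SignedMeasure X) : ℝ :=
  sSup {r | ∃ g : X → ℝ, (∀ x, |g x| ≤ 1) ∧ (∀ x y, |g x - g y| ≤ dist x y ^ ζ) ∧
    r = |sInt μ g|}

open scoped Classical in
/-- A finite measure regarded as a signed measure (and `0` on non-finite measures). -/
noncomputable def toSM {X : Type*} [MeasurableSpace X] (μ : Measure X) : SignedMeasure X :=
  if h : IsFiniteMeasure μ then @Measure.toSignedMeasure _ _ μ h else 0

/-- The restriction `μ|_γ = φ_x(γ)·π_{y*}μ_γ` of a positive finite measure on `M × K` to the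
fiber over `γ`, where `φ_x = d(π_{x*}μ)/dm₁` and `μ_γ` is the conditional (Rokhlin) fiber
measure of `μ` over the first coordinate. -/
noncomputable def fiberPos (m₁ : Measure M) (μ : Measure (M × K)) [IsFiniteMeasure μ] (γ : M) :
    SignedMeasure K :=
  (μ.fst.rnDeriv m₁ γ).toReal • toSM (μ.condKernel γ)

/-- The restriction `μ|_γ = μ⁺|_γ − μ⁻|_γ` of a signed measure on `M × K` to the fiber over
`γ`, via the Jordan decomposition. -/
noncomputable def fiberS (m₁ : Measure M) (μ : SignedMeasure (M × K)) (γ : M) :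
    SignedMeasure K :=
  fiberPos m₁ μ.toJordanDecomposition.posPart γ - fiberPos m₁ μ.toJordanDecomposition.negPart γ

/-- `‖μ‖_∞ := m₁-esssup_γ ‖μ|_γ‖_W` (with values in `ℝ≥0∞`). -/
noncomputable def infNormE (ζ : ℝ) (m₁ : Measure M) (μ : SignedMeasure (M × K)) : ℝ≥0∞ :=
  essSup (fun γ => ENNReal.ofReal (wNorm ζ (fiberS m₁ μ γ))) m₁

/-- Membership in `L^∞`: both Jordan marginals are absolutely continuous w.r.t. `m₁` and
`‖μ‖_∞ < ∞`. -/
def memLinf (ζ : ℝ) (m₁ : Measure M) (μ : SignedMeasure (M × K)) : Prop :=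
  μ.toJordanDecomposition.posPart.fst ≪ m₁ ∧ μ.toJordanDecomposition.negPart.fst ≪ m₁ ∧
    infNormE ζ m₁ μ < ⊤

/-- The marginal density `φ_x = d(π_{x*}μ)/dm₁` of a signed measure on `M × K`. -/
noncomputable def signedDensity (m₁ : Measure M) (μ : SignedMeasure (M × K)) (γ : M) : ℝ :=
  (μ.toJordanDecomposition.posPart.fst.rnDeriv m₁ γ).toReal -
    (μ.toJordanDecomposition.negPart.fst.rnDeriv m₁ γ).toReal

/-- The `ζ`-Hölder constant `H_ζ(φ)` (with values in `ℝ≥0∞`; it is `⊤` iff `φ` is not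
`ζ`-Hölder). -/
noncomputable def hC {X : Type*} [MetricSpace X] (ζ : ℝ) (φ : X → ℝ) : ℝ≥0∞ :=
  ⨆ (x : X) (y : X) (_ : x ≠ y), ENNReal.ofReal (|φ x - φ y| / dist x y ^ ζ)

/-- The `ζ`-Hölder norm `|φ|_ζ = sup|φ| + H_ζ(φ)` (with values in `ℝ≥0∞`). -/
noncomputable def hNormE {X : Type*} [MetricSpace X] (ζ : ℝ) (φ : X → ℝ) : ℝ≥0∞ :=
  (⨆ x : X, ENNReal.ofReal |φ x|) + hC ζ φ

/-- Membership in `S^∞`: `μ ∈ L^∞` and the marginal density has a `ζ`-Hölder version. -/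
def memSinf (ζ : ℝ) (m₁ : Measure M) (μ : SignedMeasure (M × K)) : Prop :=
  memLinf ζ m₁ μ ∧ ∃ φ : M → ℝ, φ =ᵐ[m₁] signedDensity m₁ μ ∧ hC ζ φ < ⊤

/-- The `S^∞` norm `‖μ‖_{S^∞} = |φ_x|_ζ + ‖μ‖_∞` (infimum of `|·|_ζ` over versions of the
marginal density; with values in `ℝ≥0∞`). -/
noncomputable def sNormE (ζ : ℝ) (m₁ : Measure M) (μ : SignedMeasure (M × K)) : ℝ≥0∞ :=
  (⨅ (φ : M → ℝ) (_ : φ =ᵐ[m₁] signedDensity m₁ μ), hNormE ζ φ) + infNormE ζ m₁ μ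

/-- The transfer (Perron–Frobenius) operator of `f` with respect to `m₁`:
`P_f φ = d(f_*(φ·m₁))/dm₁`. -/
noncomputable def Pf {X : Type*} [MeasurableSpace X] (m₁ : Measure X) (f : X → X)
    (φ : X → ℝ) : X → ℝ := fun γ =>
  (((m₁.withDensity fun x => ENNReal.ofReal (φ x)).map f).rnDeriv m₁ γ).toReal -
    (((m₁.withDensity fun x => ENNReal.ofReal (-φ x)).map f).rnDeriv m₁ γ).toReal

end Setting

namespace LYaux

lemma jd_apply {X : Type*} [MeasurableSpace X] (ν : SignedMeasure X) {A : Set X}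
    (hA : MeasurableSet A) :
    ν A = ν.toJordanDecomposition.posPart.real A - ν.toJordanDecomposition.negPart.real A := by
  conv_lhs => rw [← ν.toSignedMeasure_toJordanDecomposition]
  rw [JordanDecomposition.toSignedMeasure, VectorMeasure.sub_apply,
    Measure.toSignedMeasure_apply_measurable hA, Measure.toSignedMeasure_apply_measurable hA]

lemma int_bdd {X : Type*} [MeasurableSpace X] (a : Measure X) [IsFiniteMeasure a] {g : X → ℝ}
    (hg : Measurable g) (C : ℝ) (hC : ∀ x, |g x| ≤ C) : Integrable g a :=
  Integrable.of_bound hg.aestronglyMeasurable C (Eventually.of_forall fun x => by simpa using hC x)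

lemma sInt_eq {X : Type*} [MeasurableSpace X] (ν : SignedMeasure X) (a b : Measure X)
    [IsFiniteMeasure a] [IsFiniteMeasure b]
    (h : ∀ A, MeasurableSet A → ν A = a.real A - b.real A) {g : X → ℝ}
    (hg : Measurable g) (C : ℝ) (hC : ∀ x, |g x| ≤ C) :
    sInt ν g = ∫ x, g x ∂a - ∫ x, g x ∂b := by
  have key : ν.toJordanDecomposition.posPart + b = a + ν.toJordanDecomposition.negPart := by
    ext A hA
    have h1 := h A hA
    rw [jd_apply ν hA] at h1
    have h2 : (ν.toJordanDecomposition.posPart + b).real A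
        = (a + ν.toJordanDecomposition.negPart).real A := by
      rw [measureReal_add_apply, measureReal_add_apply]; linarith
    exact (measureReal_eq_measureReal_iff).1 h2
  have h3 : ∫ x, g x ∂(ν.toJordanDecomposition.posPart + b)
      = ∫ x, g x ∂(a + ν.toJordanDecomposition.negPart) := by rw [key]
  rw [integral_add_measure (int_bdd _ hg C hC) (int_bdd _ hg C hC),
    integral_add_measure (int_bdd _ hg C hC) (int_bdd _ hg C hC)] at h3
  unfold sInt
  linarith

lemma sInt_le {X : Type*} [MeasurableSpace X] (ν : SignedMeasure X) {g : X → ℝ}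
    (C : ℝ) (hC : ∀ x, |g x| ≤ C) :
    |sInt ν g| ≤ C * (ν.toJordanDecomposition.posPart.real Set.univ
      + ν.toJordanDecomposition.negPart.real Set.univ) := by
  unfold sInt
  have h1 := norm_integral_le_of_norm_le_const (μ := ν.toJordanDecomposition.posPart) (f := g)
    (C := C) (Eventually.of_forall fun x => by simpa using hC x)
  have h2 := norm_integral_le_of_norm_le_const (μ := ν.toJordanDecomposition.negPart) (f := g)
    (C := C) (Eventually.of_forall fun x => by simpa using hC x)
  rw [Real.norm_eq_abs] at h1 h2
  rw [abs_le] at h1 h2 ⊢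
  constructor <;> linarith [h1.1, h1.2, h2.1, h2.2]

lemma holder_cont {X : Type*} [MetricSpace X] {ζ : ℝ} (hζ : 0 < ζ) {g : X → ℝ} (C : ℝ)
    (hg : ∀ x y, |g x - g y| ≤ C * dist x y ^ ζ) : Continuous g := by
  rw [continuous_iff_continuousAt]
  intro x
  rw [ContinuousAt, tendsto_iff_dist_tendsto_zero]
  have : Tendsto (fun y => C * dist y x ^ ζ) (nhds x) (nhds 0) := by
    have h : Continuous (fun y => C * dist y x ^ ζ) :=
      continuous_const.mul ((continuous_id.dist continuous_const).rpow_const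
        (fun _ => Or.inr hζ.le))
    have := h.tendsto x
    simpa [Real.zero_rpow hζ.ne'] using this
  exact squeeze_zero (fun _ => dist_nonneg) (fun y => by rw [Real.dist_eq]; exact hg y x) this

/-- admissible test functions -/
def Adm {X : Type*} [MetricSpace X] (ζ : ℝ) (g : X → ℝ) : Prop :=
  (∀ x, |g x| ≤ 1) ∧ (∀ x y, |g x - g y| ≤ dist x y ^ ζ)

lemma Adm.cont {X : Type*} [MetricSpace X] {ζ : ℝ} (hζ : 0 < ζ) {g : X → ℝ} (hg : Adm ζ g) :
    Continuous g := holder_cont hζ 1 (by simpa using hg.2)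

lemma le_wNorm {X : Type*} [MetricSpace X] [MeasurableSpace X] {ζ : ℝ}
    (ν : SignedMeasure X) {g : X → ℝ} (hg : Adm ζ g) : |sInt ν g| ≤ wNorm ζ ν := by
  apply le_csSup
  · refine ⟨1 * (ν.toJordanDecomposition.posPart.real Set.univ
      + ν.toJordanDecomposition.negPart.real Set.univ), ?_⟩
    rintro r ⟨g, h1, -, rfl⟩
    exact sInt_le ν 1 h1
  · exact ⟨g, hg.1, hg.2, rfl⟩

lemma adm_zero {X : Type*} [MetricSpace X] (ζ : ℝ) : Adm ζ (fun _ : X => (0:ℝ)) :=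
  ⟨by simp, fun x y => by simpa using Real.rpow_nonneg dist_nonneg _⟩

lemma adm_one {X : Type*} [MetricSpace X] (ζ : ℝ) : Adm ζ (fun _ : X => (1:ℝ)) :=
  ⟨by simp, fun x y => by simpa using Real.rpow_nonneg dist_nonneg _⟩

lemma wNorm_le {X : Type*} [MetricSpace X] [CompactSpace X] [MeasurableSpace X] [BorelSpace X]
    {ζ : ℝ} (hζ : 0 < ζ) (ν : SignedMeasure X) (c : ℝ)
    (D : ℕ → C(X, ℝ)) (hD : ∀ g : C(X, ℝ), Adm ζ g → ∀ ε > 0, ∃ n, ‖g - D n‖ < ε)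
    (h : ∀ n, |sInt ν (D n)| ≤ c) : wNorm ζ ν ≤ c := by
  apply csSup_le
  · exact ⟨_, fun _ => 0, (adm_zero ζ).1, (adm_zero ζ).2, rfl⟩
  rintro r ⟨g, h1, h2, rfl⟩
  have hg : Adm ζ g := ⟨h1, h2⟩
  obtain ⟨k, rfl⟩ : ∃ k : C(X, ℝ), (k : X → ℝ) = g := ⟨⟨g, hg.cont hζ⟩, rfl⟩
  obtain ⟨T, hT⟩ : ∃ T, T = ν.toJordanDecomposition.posPart.real Set.univ
      + ν.toJordanDecomposition.negPart.real Set.univ := ⟨_, rfl⟩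
  have hT0 : 0 ≤ T := by rw [hT]; exact add_nonneg measureReal_nonneg measureReal_nonneg
  apply _root_.le_of_forall_pos_le_add
  intro ε hε
  have hT1 : 0 < T + 1 := by linarith
  obtain ⟨n, hn⟩ := hD k hg (ε / (T + 1)) (div_pos hε hT1)
  have hb : ∀ x, |k x - D n x| ≤ ε / (T + 1) := fun x =>
    (((k - D n).norm_coe_le_norm x).trans hn.le)
  have hi : ∀ (a : Measure X) [IsFiniteMeasure a] (k : C(X, ℝ)), Integrable (fun x => k x) a :=
    fun a _ k => int_bdd a k.continuous.measurable ‖k‖ (fun x => k.norm_coe_le_norm x)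
  have hsub : sInt ν k = sInt ν (D n) + sInt ν (fun x => k x - D n x) := by
    unfold sInt
    rw [integral_sub (hi _ k) (hi _ (D n)), integral_sub (hi _ k) (hi _ (D n))]; ring
  have h3 := sInt_le ν _ hb
  rw [← hT] at h3
  have h4 : ε / (T + 1) * T ≤ ε := by
    rw [div_mul_eq_mul_div, div_le_iff₀ hT1]; linarith
  rw [hsub]
  exact (abs_add_le _ _).trans (add_le_add (h n) (h3.trans h4))

lemma exists_dense {X : Type*} [MetricSpace X] [CompactSpace X] (ζ : ℝ) :
    ∃ D : ℕ → C(X, ℝ), (∀ n, Adm ζ (D n)) ∧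
      ∀ g : C(X, ℝ), Adm ζ g → ∀ ε > 0, ∃ n, ‖g - D n‖ < ε := by
  let S : Set C(X, ℝ) := {g | Adm ζ g}
  haveI : Nonempty S := ⟨⟨ContinuousMap.const X 0, adm_zero ζ⟩⟩
  refine ⟨fun n => (TopologicalSpace.denseSeq S n : C(X, ℝ)),
    fun n => (TopologicalSpace.denseSeq S n).2, fun g hg ε hε => ?_⟩
  obtain ⟨n, hn⟩ := (TopologicalSpace.denseRange_denseSeq S).exists_dist_lt (⟨g, hg⟩ : S) hε
  refine ⟨n, ?_⟩
  rwa [Subtype.dist_eq, dist_eq_norm] at hn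

section fib

variable {M : Type*} {K : Type*}
variable [MetricSpace M] [CompactSpace M] [MeasurableSpace M] [BorelSpace M]
variable [MetricSpace K] [CompactSpace K] [MeasurableSpace K] [BorelSpace K]
variable [StandardBorelSpace K] [Nonempty K]

lemma sInt_fiberS (m₁ : Measure M) (μ : SignedMeasure (M × K)) (γ : M) {g : K → ℝ}
    (hg : Measurable g) (C : ℝ) (hC : ∀ x, |g x| ≤ C) :
    sInt (fiberS m₁ μ γ) g =
      (μ.toJordanDecomposition.posPart.fst.rnDeriv m₁ γ).toReal *
        ∫ z, g z ∂(μ.toJordanDecomposition.posPart.condKernel γ) -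
      (μ.toJordanDecomposition.negPart.fst.rnDeriv m₁ γ).toReal *
        ∫ z, g z ∂(μ.toJordanDecomposition.negPart.condKernel γ) := by
  have hfin : ∀ (r : ℝ) (a : Measure K) [IsFiniteMeasure a],
      IsFiniteMeasure ((ENNReal.ofReal r) • a) := fun r a _ =>
    Measure.smul_finite a ENNReal.ofReal_ne_top
  haveI := hfin (μ.toJordanDecomposition.posPart.fst.rnDeriv m₁ γ).toReal
    (μ.toJordanDecomposition.posPart.condKernel γ)
  haveI := hfin (μ.toJordanDecomposition.negPart.fst.rnDeriv m₁ γ).toReal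
    (μ.toJordanDecomposition.negPart.condKernel γ)
  rw [sInt_eq (fiberS m₁ μ γ)
    (ENNReal.ofReal (μ.toJordanDecomposition.posPart.fst.rnDeriv m₁ γ).toReal •
      μ.toJordanDecomposition.posPart.condKernel γ)
    (ENNReal.ofReal (μ.toJordanDecomposition.negPart.fst.rnDeriv m₁ γ).toReal •
      μ.toJordanDecomposition.negPart.condKernel γ) _ hg C hC]
  · rw [integral_smul_measure, integral_smul_measure, ENNReal.toReal_ofReal toReal_nonneg,
      ENNReal.toReal_ofReal toReal_nonneg, smul_eq_mul, smul_eq_mul]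
  · intro A hA
    have e : ∀ (a : Measure K) [IsFiniteMeasure a], toSM a A = a.real A := by
      intro a ha
      unfold toSM
      rw [dif_pos ha, Measure.toSignedMeasure_apply_measurable hA]
    unfold fiberS fiberPos
    rw [VectorMeasure.sub_apply, VectorMeasure.smul_apply, VectorMeasure.smul_apply, e, e,
      measureReal_ennreal_smul_apply, measureReal_ennreal_smul_apply,
      ENNReal.toReal_ofReal toReal_nonneg,
      ENNReal.toReal_ofReal toReal_nonneg, smul_eq_mul, smul_eq_mul]

lemma sInt_fiberS_one (m₁ : Measure M) (μ : SignedMeasure (M × K)) (γ : M) :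
    sInt (fiberS m₁ μ γ) (fun _ => 1) = signedDensity m₁ μ γ := by
  rw [sInt_fiberS m₁ μ γ measurable_const 1 (by simp)]
  simp [signedDensity]

/-- Jordan marginals abs cont -/
def MAC (m₁ : Measure M) (μ : SignedMeasure (M × K)) : Prop :=
  μ.toJordanDecomposition.posPart.fst ≪ m₁ ∧ μ.toJordanDecomposition.negPart.fst ≪ m₁

lemma sInt_disint (m₁ : Measure M) [IsProbabilityMeasure m₁] (μ : SignedMeasure (M × K))
    (hμ : MAC m₁ μ) {H : M × K → ℝ} (hH : Measurable H) (C : ℝ) (hC : ∀ x, |H x| ≤ C) :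
    Integrable (fun γ => sInt (fiberS m₁ μ γ) (fun z => H (γ, z))) m₁ ∧
      sInt μ H = ∫ γ, sInt (fiberS m₁ μ γ) (fun z => H (γ, z)) ∂m₁ := by
  have e : ∀ γ, sInt (fiberS m₁ μ γ) (fun z => H (γ, z)) = _ := fun γ =>
    sInt_fiberS m₁ μ γ (g := fun z => H (γ, z)) (hH.comp measurable_prodMk_left) C (fun z => hC _)
  simp_rw [e]
  have k : ∀ (ρ : Measure (M × K)) [IsFiniteMeasure ρ], ρ.fst ≪ m₁ →
      Integrable (fun γ => (ρ.fst.rnDeriv m₁ γ).toReal * ∫ z, H (γ, z) ∂(ρ.condKernel γ)) m₁ ∧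
      ∫ γ, (ρ.fst.rnDeriv m₁ γ).toReal * ∫ z, H (γ, z) ∂(ρ.condKernel γ) ∂m₁ = ∫ x, H x ∂ρ := by
    intro ρ _ hρ
    have hi := int_bdd ρ hH C hC
    refine ⟨(integrable_rnDeriv_smul_iff hρ).2 hi.integral_condKernel, ?_⟩
    rw [← Measure.integral_condKernel hi, ← integral_rnDeriv_smul hρ]
    rfl
  obtain ⟨i1, j1⟩ := k _ hμ.1
  obtain ⟨i2, j2⟩ := k _ hμ.2
  refine ⟨i1.sub i2, ?_⟩
  rw [integral_sub i1 i2, j1, j2, sInt]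

lemma map_apply_eq (μ : SignedMeasure (M × K)) {F : M × K → M × K} (hF : Measurable F)
    {A : Set (M × K)} (hA : MeasurableSet A) :
    μ.map F A = (μ.toJordanDecomposition.posPart.map F).real A -
      (μ.toJordanDecomposition.negPart.map F).real A := by
  rw [VectorMeasure.map_apply _ hF hA, jd_apply μ (hF hA), map_measureReal_apply hF hA,
    map_measureReal_apply hF hA]

lemma sInt_map (μ : SignedMeasure (M × K)) {F : M × K → M × K} (hF : Measurable F)
    {H : M × K → ℝ} (hH : Measurable H) (C : ℝ) (hC : ∀ x, |H x| ≤ C) :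
    sInt (μ.map F) H = sInt μ (fun p => H (F p)) := by
  rw [sInt_eq _ _ _ (fun A hA => map_apply_eq μ hF hA) hH C hC,
    integral_map hF.aemeasurable hH.aestronglyMeasurable,
    integral_map hF.aemeasurable hH.aestronglyMeasurable]
  rfl

lemma MAC_map (m₁ : Measure M) (μ : SignedMeasure (M × K)) (hμ : MAC m₁ μ)
    {F : M × K → M × K} (hF : Measurable F) {f : M → M} (hf : MeasurePreserving f m₁ m₁)
    (hFf : ∀ p, (F p).1 = f p.1) : MAC m₁ (μ.map F) := by
  have hz : ∀ A : Set M, MeasurableSet A → m₁ A = 0 → ∀ E : Set (M × K), MeasurableSet E →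
      E ⊆ Prod.fst ⁻¹' A → μ.map F E = 0 := by
    intro A hA h0 E hE hEA
    have h1 : m₁ (f ⁻¹' A) = 0 := by rw [hf.measure_preimage hA.nullMeasurableSet, h0]
    rw [VectorMeasure.map_apply _ hF hE, jd_apply μ (hF hE)]
    have k : ∀ (ρ : Measure (M × K)), ρ.fst ≪ m₁ → ρ.real (F ⁻¹' E) = 0 := by
      intro ρ hρ
      have := hρ h1
      rw [Measure.fst_apply (hf.measurable hA)] at this
      have h2 : ρ (F ⁻¹' E) = 0 := by
        refine measure_mono_null ?_ this
        intro p hp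
        have := hEA hp
        simpa [hFf] using this
      simp [Measure.real, h2]
    rw [k _ hμ.1, k _ hμ.2, sub_zero]
  change MAC m₁ (μ.map F : SignedMeasure (M × K))
  generalize (μ.map F : SignedMeasure (M × K)) = ν at hz ⊢
  change SignedMeasure (M × K) at ν
  obtain ⟨S, hS, hS1, hS2⟩ := ν.toJordanDecomposition.mutuallySingular
  constructor
  · refine Measure.AbsolutelyContinuous.mk fun A hA h0 => ?_
    rw [Measure.fst_apply hA]
    have hE : MeasurableSet (Prod.fst ⁻¹' A ∩ Sᶜ : Set (M × K)) := (measurable_fst hA).inter hS.compl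
    have h1 := hz A hA h0 _ hE Set.inter_subset_left
    rw [jd_apply _ hE] at h1
    have h2 : ν.toJordanDecomposition.negPart.real (Prod.fst ⁻¹' A ∩ Sᶜ) = 0 := by
      rw [Measure.real, measure_mono_null Set.inter_subset_right hS2]; rfl
    rw [h2, sub_zero, measureReal_eq_zero_iff] at h1
    have h3 : ν.toJordanDecomposition.posPart (Prod.fst ⁻¹' A ∩ S) = 0 :=
      measure_mono_null Set.inter_subset_right hS1
    rw [← Set.inter_union_compl (Prod.fst ⁻¹' A) S]
    exact measure_union_null h3 h1
  · refine Measure.AbsolutelyContinuous.mk fun A hA h0 => ?_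
    rw [Measure.fst_apply hA]
    have hE : MeasurableSet (Prod.fst ⁻¹' A ∩ S : Set (M × K)) := (measurable_fst hA).inter hS
    have h1 := hz A hA h0 _ hE Set.inter_subset_left
    rw [jd_apply _ hE] at h1
    have h2 : ν.toJordanDecomposition.posPart.real (Prod.fst ⁻¹' A ∩ S) = 0 := by
      rw [Measure.real, measure_mono_null Set.inter_subset_right hS1]; rfl
    rw [h2, zero_sub, neg_eq_zero, measureReal_eq_zero_iff] at h1
    have h3 : ν.toJordanDecomposition.negPart (Prod.fst ⁻¹' A ∩ Sᶜ) = 0 :=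
      measure_mono_null Set.inter_subset_right hS2
    rw [← Set.inter_union_compl (Prod.fst ⁻¹' A) S]
    exact measure_union_null h1 h3

lemma sd_integrable (m₁ : Measure M) (μ : SignedMeasure (M × K)) :
    Integrable (signedDensity m₁ μ) m₁ :=
  Measure.integrable_toReal_rnDeriv.sub Measure.integrable_toReal_rnDeriv

lemma sd_setIntegral (m₁ : Measure M) [IsProbabilityMeasure m₁] (μ : SignedMeasure (M × K))
    (hμ : MAC m₁ μ) {A : Set M} (hA : MeasurableSet A) :
    ∫ x in A, signedDensity m₁ μ x ∂m₁ = μ (Prod.fst ⁻¹' A) := by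
  unfold signedDensity
  rw [integral_sub Measure.integrable_toReal_rnDeriv.integrableOn
    Measure.integrable_toReal_rnDeriv.integrableOn,
    Measure.setIntegral_toReal_rnDeriv hμ.1, Measure.setIntegral_toReal_rnDeriv hμ.2,
    jd_apply μ (measurable_fst hA), Measure.fst, Measure.fst,
    map_measureReal_apply measurable_fst hA, map_measureReal_apply measurable_fst hA]

lemma infNorm_ae (ζ : ℝ) (m₁ : Measure M) (μ : SignedMeasure (M × K))
    (h : infNormE ζ m₁ μ < ⊤) :
    ∀ᵐ γ ∂m₁, wNorm ζ (fiberS m₁ μ γ) ≤ (infNormE ζ m₁ μ).toReal := by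
  have := ENNReal.ae_le_essSup (μ := m₁) (fun γ => ENNReal.ofReal (wNorm ζ (fiberS m₁ μ γ)))
  filter_upwards [this] with γ hγ
  exact (ENNReal.ofReal_le_iff_le_toReal h.ne).1 hγ

lemma infNorm_map {ζ : ℝ} (hζ : 0 < ζ) (m₁ : Measure M) [IsProbabilityMeasure m₁]
    (μ : SignedMeasure (M × K)) (hμ : MAC m₁ μ) (hfin : infNormE ζ m₁ μ < ⊤)
    {F : M × K → M × K} (hF : Measurable F) {f : M → M} (hf : MeasurePreserving f m₁ m₁)
    (hFf : ∀ p, (F p).1 = f p.1)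
    (hc : ∀ᵐ x ∂m₁, ∀ z₁ z₂ : K, dist (F (x, z₁)).2 (F (x, z₂)).2 ≤ dist z₁ z₂) :
    infNormE ζ m₁ (μ.map F) ≤ infNormE ζ m₁ μ := by
  set c := (infNormE ζ m₁ μ).toReal with hcdef
  have hw := infNorm_ae ζ m₁ μ hfin
  have hν := MAC_map m₁ μ hμ hF hf hFf
  obtain ⟨D, hD1, hD2⟩ := exists_dense (X := K) ζ
  have up : ∀ g : K → ℝ, Adm ζ g → ∀ᵐ γ ∂m₁, sInt (fiberS m₁ (μ.map F) γ) g ≤ c := by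
    intro g hg
    have hgm : Measurable g := (hg.cont hζ).measurable
    have hi := (sInt_disint m₁ (μ.map F) hν (H := fun p => g p.2) (hgm.comp measurable_snd) 1
      (fun p => hg.1 _)).1
    refine ae_le_of_forall_setIntegral_le hi (integrable_const c) ?_
    intro A hA _
    -- indicator functions
    let H : M × K → ℝ := (Prod.fst ⁻¹' A).indicator (fun p => g p.2)
    have hHm : Measurable H := (hgm.comp measurable_snd).indicator (measurable_fst hA)
    have hHb : ∀ p, |H p| ≤ 1 := by
      intro p
      by_cases hp : p ∈ Prod.fst ⁻¹' A
      · simp only [H, Set.indicator_of_mem hp]; exact hg.1 _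
      · simp [H, Set.indicator_of_notMem hp]
    have s0 : ∀ ν : SignedMeasure K, sInt ν (fun _ => 0) = 0 := by intro ν; simp [sInt]
    have e1 : ∫ γ in A, sInt (fiberS m₁ (μ.map F) γ) g ∂m₁ = sInt (μ.map F) H := by
      rw [(sInt_disint m₁ (μ.map F) hν hHm 1 hHb).2, ← integral_indicator hA]
      refine integral_congr_ae (Eventually.of_forall fun γ => ?_)
      by_cases hγ : γ ∈ A
      · simp only [Set.indicator_of_mem hγ]
        congr 1; funext z
        simp [H, Set.indicator, hγ]
      · simp only [Set.indicator_of_notMem hγ]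
        rw [← s0 (fiberS m₁ (μ.map F) γ)]
        congr 1; funext z
        simp [H, Set.indicator, hγ]
    have hfA := hf.measurable hA
    obtain ⟨i2, e2⟩ := sInt_disint m₁ μ hμ (H := fun p => H (F p)) (hHm.comp hF) 1 (fun p => hHb _)
    rw [e1, sInt_map μ hF hHm 1 hHb, e2]
    calc _ ≤ ∫ γ, (f ⁻¹' A).indicator (fun _ => c) γ ∂m₁ := by
          refine integral_mono_ae i2 ((integrable_const c).indicator hfA) ?_
          filter_upwards [hw, hc] with x hx hcx
          by_cases hxA : x ∈ f ⁻¹' A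
          · simp only [Set.indicator_of_mem hxA]
            have : (fun z => H (F (x, z))) = fun z => g (F (x, z)).2 := by
              funext z
              have : f x ∈ A := hxA
              simp [H, Set.indicator, hFf, this]
            rw [this]
            refine (le_abs_self _).trans ((le_wNorm _ ⟨fun z => hg.1 _, fun y z => ?_⟩).trans hx)
            exact (hg.2 _ _).trans (Real.rpow_le_rpow dist_nonneg (hcx y z) hζ.le)
          · simp only [Set.indicator_of_notMem hxA]
            rw [← s0 (fiberS m₁ μ x)]
            apply le_of_eq
            congr 1; funext z
            have : f x ∉ A := hxA
            simp [H, Set.indicator, hFf, this]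
      _ = ∫ γ in A, c ∂m₁ := by
          rw [integral_indicator hfA, setIntegral_const, setIntegral_const, Measure.real,
            Measure.real, hf.measure_preimage hA.nullMeasurableSet]
  have up2 : ∀ᵐ γ ∂m₁, ∀ n, |sInt (fiberS m₁ (μ.map F) γ) (D n)| ≤ c := by
    rw [ae_all_iff]
    intro n
    have hneg : Adm ζ (fun z => - D n z) := by
      refine ⟨fun z => by simpa using (hD1 n).1 z, fun y z => ?_⟩
      have := (hD1 n).2 z y
      rw [dist_comm] at this
      convert this using 2; ring
    filter_upwards [up _ (hD1 n), up _ hneg] with γ h1 h2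
    rw [abs_le]
    refine ⟨?_, h1⟩
    have : sInt (fiberS m₁ (μ.map F) γ) (fun z => - D n z) = - sInt (fiberS m₁ (μ.map F) γ) (D n) := by
      unfold sInt
      rw [integral_neg, integral_neg]; ring
    linarith
  refine essSup_le_of_ae_le _ ?_
  filter_upwards [up2] with γ hγ
  exact (ENNReal.ofReal_le_iff_le_toReal hfin.ne).2 (wNorm_le hζ _ c D hD2 hγ)

lemma Pf_spec (m₁ : Measure M) [IsProbabilityMeasure m₁] {f : M → M}
    (hf : MeasurePreserving f m₁ m₁) {g : M → ℝ} (hg : Integrable g m₁) :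
    Integrable (Pf m₁ f g) m₁ ∧ ∀ A, MeasurableSet A →
      ∫ x in A, Pf m₁ f g x ∂m₁ = ∫ x in f ⁻¹' A, g x ∂m₁ := by
  haveI := isFiniteMeasure_withDensity_ofReal hg.2
  haveI := isFiniteMeasure_withDensity_ofReal hg.neg.2
  have ac : ∀ u : M → ℝ≥0∞, (m₁.withDensity u).map f ≪ m₁ := by
    intro u
    have := (withDensity_absolutelyContinuous m₁ u).map hf.measurable
    rwa [hf.map_eq] at this
  have hi1 : Integrable (fun γ => (((m₁.withDensity fun x => ENNReal.ofReal (g x)).map f).rnDeriv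
    m₁ γ).toReal) m₁ := Measure.integrable_toReal_rnDeriv
  have hi2 : Integrable (fun γ => (((m₁.withDensity fun x => ENNReal.ofReal (-g x)).map f).rnDeriv
    m₁ γ).toReal) m₁ := by
    haveI : IsFiniteMeasure (m₁.withDensity fun x => ENNReal.ofReal (-g x)) := by assumption
    exact Measure.integrable_toReal_rnDeriv
  haveI : IsFiniteMeasure (m₁.withDensity fun x => ENNReal.ofReal (-g x)) := by assumption
  refine ⟨hi1.sub hi2, fun A hA => ?_⟩
  unfold Pf
  have hfA := hf.measurable hA
  rw [integral_sub hi1.integrableOn hi2.integrableOn, Measure.setIntegral_toReal_rnDeriv (ac _),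
    Measure.setIntegral_toReal_rnDeriv (ac _), map_measureReal_apply hf.measurable hA,
    map_measureReal_apply hf.measurable hA, Measure.real, Measure.real,
    withDensity_apply _ hfA, withDensity_apply _ hfA,
    integral_eq_lintegral_pos_part_sub_lintegral_neg_part hg.integrableOn]

lemma Pf_iter (m₁ : Measure M) [IsProbabilityMeasure m₁] {f : M → M}
    (hf : MeasurePreserving f m₁ m₁) {g : M → ℝ} (hg : Integrable g m₁) (n : ℕ) :
    Integrable ((Pf m₁ f)^[n] g) m₁ ∧ ∀ A, MeasurableSet A →
      ∫ x in A, (Pf m₁ f)^[n] g x ∂m₁ = ∫ x in f^[n] ⁻¹' A, g x ∂m₁ := by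
  induction n with
  | zero => exact ⟨hg, fun A _ => rfl⟩
  | succ n ih =>
    rw [Function.iterate_succ_apply']
    refine ⟨(Pf_spec m₁ hf ih.1).1, fun A hA => ?_⟩
    rw [(Pf_spec m₁ hf ih.1).2 A hA, ih.2 _ (hf.measurable hA), Function.iterate_succ',
      Set.preimage_comp]

lemma hC_cont {X : Type*} [MetricSpace X] {ζ : ℝ} (hζ : 0 < ζ) {φ : X → ℝ} (h : hC ζ φ < ⊤) :
    Continuous φ := by
  refine holder_cont hζ (hC ζ φ).toReal fun x y => ?_
  by_cases hxy : x = y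
  · subst hxy; simp [Real.zero_rpow hζ.ne']
  have h1 : ENNReal.ofReal (|φ x - φ y| / dist x y ^ ζ) ≤ hC ζ φ :=
    le_iSup_of_le x (le_iSup_of_le y (le_iSup_of_le hxy le_rfl))
  have h2 := (ENNReal.ofReal_le_iff_le_toReal h.ne).1 h1
  rwa [div_le_iff₀ (Real.rpow_pos_of_pos (dist_pos.2 hxy) _)] at h2

/-- truncation -/
noncomputable def clamp (c x : ℝ) : ℝ := max (-c) (min c x)

lemma clamp_eq {c x : ℝ} (h : |x| ≤ c) : clamp c x = x := by
  rw [abs_le] at h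
  rw [clamp, min_eq_right h.2, max_eq_right h.1]

lemma clamp_le {c : ℝ} (hc : 0 ≤ c) (x : ℝ) : |clamp c x| ≤ c := by
  rw [abs_le, clamp]
  exact ⟨le_max_left _ _, max_le (by linarith) (min_le_left _ _)⟩

lemma clamp_le' {c : ℝ} (hc : 0 ≤ c) (x : ℝ) : |clamp c x| ≤ |x| := by
  by_cases h : |x| ≤ c
  · rw [clamp_eq h]
  · exact (clamp_le hc x).trans (not_le.1 h).le

lemma clamp_sub (c x y : ℝ) : |clamp c x - clamp c y| ≤ |x - y| := by
  unfold clamp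
  refine (abs_max_sub_max_le_max _ _ _ _).trans (max_le (by simp) ?_)
  exact (abs_min_sub_min_le_max _ _ _ _).trans (max_le (by simp) le_rfl)

lemma iter_struct (m₁ : Measure M) {f : M → M} (hf : MeasurePreserving f m₁ m₁)
    {F : M × K → M × K} (hFf : ∀ p, (F p).1 = f p.1)
    (hc : ∀ᵐ x ∂m₁, ∀ z₁ z₂ : K, dist (F (x, z₁)).2 (F (x, z₂)).2 ≤ dist z₁ z₂) (n : ℕ) :
    (∀ p, (F^[n] p).1 = f^[n] p.1) ∧
    ∀ᵐ x ∂m₁, ∀ z₁ z₂ : K, dist (F^[n] (x, z₁)).2 (F^[n] (x, z₂)).2 ≤ dist z₁ z₂ := by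
  induction n with
  | zero => exact ⟨fun _ => rfl, by simp⟩
  | succ n ih =>
    refine ⟨fun p => by rw [Function.iterate_succ_apply, ih.1, hFf, Function.iterate_succ_apply],
      ?_⟩
    have h2 := hf.quasiMeasurePreserving.ae ih.2
    filter_upwards [h2, hc] with x h1 h3 z₁ z₂
    have e : ∀ z, F (x, z) = (f x, (F (x, z)).2) := fun z => Prod.ext (hFf _) rfl
    rw [Function.iterate_succ_apply, Function.iterate_succ_apply, e z₁, e z₂]
    exact (h1 _ _).trans (h3 _ _)

end fib

end LYaux


/-- **Lasota–Yorke inequality for `S^∞`.** If the transfer operator `P_f`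
satisfies a Lasota–Yorke inequality on `ζ`-Hölder functions, then there exist `A, B₂ > 0` and
`0 < λ < 1` such that for all `μ ∈ S^∞` and all `n ≥ 1`:
`‖F_*^n μ‖_{S^∞} ≤ A·λ^n·‖μ‖_{S^∞} + B₂·‖μ‖_∞`. -/
theorem lasota_yorke_Sinf {M K : Type*}
    [MetricSpace M] [CompactSpace M] [MeasurableSpace M] [BorelSpace M]
    [MetricSpace K] [CompactSpace K] [MeasurableSpace K] [BorelSpace K]
    [StandardBorelSpace K] [Nonempty K]
    (ζ : ℝ) (hζ0 : 0 < ζ) (hζ1 : ζ ≤ 1)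
    (hdM : Metric.diam (Set.univ : Set M) ≤ 1) (hdK : Metric.diam (Set.univ : Set K) ≤ 1)
    (m₁ : Measure M) [IsProbabilityMeasure m₁]
    (f : M → M) (hf : Measurable f) (hfinv : m₁.map f = m₁)
    (G : M × K → K) (hG : Measurable G)
    (α : ℝ) (hα0 : 0 < α) (hα1 : α < 1)
    (hGc : ∀ᵐ x ∂m₁, ∀ z₁ z₂ : K, dist (G (x, z₁)) (G (x, z₂)) ≤ α * dist z₁ z₂)
    (F : M × K → M × K) (hF : ∀ p, F p = (f p.1, G p))
    -- Lasota–Yorke inequality for `P_f` on `ζ`-Hölder functions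
    (B₃ C₂ β₂ : ℝ) (hB₃ : 0 < B₃) (hC₂ : 0 < C₂) (hβ₂0 : 0 < β₂) (hβ₂1 : β₂ < 1)
    (hLY : ∀ g : M → ℝ, hC ζ g < ⊤ → ∀ n : ℕ, 1 ≤ n →
      ∃ ψ : M → ℝ, ψ =ᵐ[m₁] (Pf m₁ f)^[n] g ∧
        hNormE ζ ψ ≤ ENNReal.ofReal (B₃ * β₂ ^ n) * hNormE ζ g +
          ENNReal.ofReal C₂ * (⨆ x : M, ENNReal.ofReal |g x|)) :
    ∃ A B₂ lam : ℝ, 0 < A ∧ 0 < B₂ ∧ 0 < lam ∧ lam < 1 ∧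
      ∀ μ : SignedMeasure (M × K), memSinf ζ m₁ μ → ∀ n : ℕ, 1 ≤ n →
        sNormE ζ m₁ (μ.map (F^[n])) ≤
          ENNReal.ofReal (A * lam ^ n) * sNormE ζ m₁ μ +
            ENNReal.ofReal B₂ * infNormE ζ m₁ μ := by
  refine ⟨B₃, C₂ + 1, β₂, hB₃, by linarith, hβ₂0, hβ₂1, fun μ hμ n hn => ?_⟩
  obtain ⟨⟨ha1, ha2, hfin⟩, -⟩ := hμ
  have hmac : LYaux.MAC m₁ μ := ⟨ha1, ha2⟩
  have hmp : MeasurePreserving f m₁ m₁ := ⟨hf, hfinv⟩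
  have hFm : Measurable F := by
    have : F = fun p => (f p.1, G p) := funext hF
    rw [this]
    exact (hf.comp measurable_fst).prodMk hG
  have hFf : ∀ p, (F p).1 = f p.1 := fun p => by rw [hF]
  have hFc : ∀ᵐ x ∂m₁, ∀ z₁ z₂ : K, dist (F (x, z₁)).2 (F (x, z₂)).2 ≤ dist z₁ z₂ := by
    filter_upwards [hGc] with x hx z₁ z₂
    rw [hF, hF]
    refine (hx z₁ z₂).trans ?_
    nlinarith [dist_nonneg (x := z₁) (y := z₂)]
  obtain ⟨hn1, hn2⟩ := LYaux.iter_struct m₁ hmp hFf hFc n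
  have hinf := LYaux.infNorm_map hζ0 m₁ μ hmac hfin (hFm.iterate n) (hmp.iterate n) hn1 hn2
  have hmac' := LYaux.MAC_map m₁ μ hmac (hFm.iterate n) (hmp.iterate n) hn1
  set c := (infNormE ζ m₁ μ).toReal with hcdef
  have hc0 : 0 ≤ c := toReal_nonneg
  have hcE : ENNReal.ofReal c = infNormE ζ m₁ μ := ENNReal.ofReal_toReal hfin.ne
  have hbd : ∀ᵐ γ ∂m₁, |signedDensity m₁ μ γ| ≤ c := by
    filter_upwards [LYaux.infNorm_ae ζ m₁ μ hfin] with γ hγ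
    rw [← LYaux.sInt_fiberS_one]
    exact (LYaux.le_wNorm _ (LYaux.adm_one ζ)).trans hγ
  have hpos : 0 < B₃ * β₂ ^ n := by positivity
  have key : ∀ φ : M → ℝ, φ =ᵐ[m₁] signedDensity m₁ μ →
      (⨅ (ψ : M → ℝ) (_ : ψ =ᵐ[m₁] signedDensity m₁ (μ.map (F^[n]))), hNormE ζ ψ) ≤
        ENNReal.ofReal (B₃ * β₂ ^ n) * hNormE ζ φ + ENNReal.ofReal C₂ * infNormE ζ m₁ μ := by
    intro φ hφ
    by_cases hφC : hC ζ φ < ⊤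
    swap
    · have : hNormE ζ φ = ⊤ := by rw [hNormE, not_lt_top_iff.1 hφC, add_top]
      rw [this, ENNReal.mul_top (by simpa using hpos), top_add]
      exact le_top
    let φ' : M → ℝ := fun x => LYaux.clamp c (φ x)
    have hφ' : φ' =ᵐ[m₁] signedDensity m₁ μ := by
      filter_upwards [hφ, hbd] with x h1 h2
      simp only [φ', h1, LYaux.clamp_eq h2]
    have hCle : hC ζ φ' ≤ hC ζ φ := by
      refine iSup_mono fun x => iSup_mono fun y => iSup_mono fun _ => ?_
      exact ENNReal.ofReal_le_ofReal (div_le_div_of_nonneg_right (LYaux.clamp_sub _ _ _)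
        (Real.rpow_nonneg dist_nonneg _))
    have hNle : hNormE ζ φ' ≤ hNormE ζ φ :=
      add_le_add (iSup_mono fun x => ENNReal.ofReal_le_ofReal (LYaux.clamp_le' hc0 _)) hCle
    have hsup : (⨆ x : M, ENNReal.ofReal |φ' x|) ≤ infNormE ζ m₁ μ := by
      rw [← hcE]
      exact iSup_le fun x => ENNReal.ofReal_le_ofReal (LYaux.clamp_le hc0 _)
    obtain ⟨ψ, hψ1, hψ2⟩ := hLY φ' (hCle.trans_lt hφC) n hn
    have hφi : Integrable φ' m₁ := (LYaux.sd_integrable m₁ μ).congr hφ'.symm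
    obtain ⟨hPi, hPs⟩ := LYaux.Pf_iter m₁ hmp hφi n
    have hψ : ψ =ᵐ[m₁] signedDensity m₁ (μ.map (F^[n])) := by
      refine hψ1.trans (Integrable.ae_eq_of_forall_setIntegral_eq _ _ hPi
        (LYaux.sd_integrable m₁ _) fun A hA _ => ?_)
      have hfA := (hf.iterate n) hA
      rw [hPs A hA, LYaux.sd_setIntegral m₁ _ hmac' hA,
        VectorMeasure.map_apply _ (hFm.iterate n) (measurable_fst hA),
        integral_congr_ae (ae_restrict_of_ae hφ'), LYaux.sd_setIntegral m₁ μ hmac hfA]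
      congr 1
      ext p
      simp [hn1]
    exact (iInf₂_le ψ hψ).trans (hψ2.trans (by gcongr))
  have key2 : (⨅ (ψ : M → ℝ) (_ : ψ =ᵐ[m₁] signedDensity m₁ (μ.map (F^[n]))), hNormE ζ ψ) ≤
      ENNReal.ofReal (B₃ * β₂ ^ n) *
        (⨅ (φ : M → ℝ) (_ : φ =ᵐ[m₁] signedDensity m₁ μ), hNormE ζ φ) +
        ENNReal.ofReal C₂ * infNormE ζ m₁ μ := by
    have h0 : ENNReal.ofReal (B₃ * β₂ ^ n) ≠ 0 := by simpa using hpos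
    rw [ENNReal.mul_iInf_of_ne h0 ofReal_ne_top, ENNReal.iInf_add]
    refine le_iInf fun φ => ?_
    rw [ENNReal.mul_iInf_of_ne h0 ofReal_ne_top, ENNReal.iInf_add]
    exact le_iInf fun hφ => key φ hφ
  unfold sNormE
  rw [ENNReal.ofReal_add hC₂.le zero_le_one, ENNReal.ofReal_one, add_mul, one_mul, ← add_assoc]
  refine add_le_add (key2.trans ?_) hinf
  gcongr
  exact le_self_add
end

section
/- Let η : ℝ² → ℝ be the standard mollifier and, for q > 0, let A_q := { z ∈ ℝ² : 1−q < |z| < 1 }. Then for every 0 < ζ ≤ 1, the quantity sup_{q>0} ( ∫_{A_q} η(z) dz ) / q^ζ is finite. -/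
open MeasureTheory

/-- Let `η : ℝ² → ℝ` be the standard mollifier,
`η(z) = c·exp(1/(|z|²−1))` for `|z| < 1` and `η(z) = 0` otherwise, normalized so that
`∫ η = 1`. For `q > 0` let `A_q = {z : 1−q < |z| < 1}`. Then for every `0 < ζ ≤ 1` the
quantity `sup_{q>0} (∫_{A_q} η) / q^ζ` is finite. -/
theorem mollifier_annulus_sup_finite (c : ℝ) (hc : 0 < c)
    (η : EuclideanSpace ℝ (Fin 2) → ℝ)
    (hη : ∀ z, η z = if ‖z‖ < 1 then c * Real.exp (1 / (‖z‖ ^ 2 - 1)) else 0)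
    (hnorm : ∫ z, η z = 1)
    (ζ : ℝ) (hζ0 : 0 < ζ) (hζ1 : ζ ≤ 1) :
    BddAbove (Set.range fun q : {q : ℝ // 0 < q} =>
      (∫ z in {z : EuclideanSpace ℝ (Fin 2) | 1 - q.1 < ‖z‖ ∧ ‖z‖ < 1}, η z) / q.1 ^ ζ) := by
  refine ⟨2 * c * volume.real (Metric.ball (0 : EuclideanSpace ℝ (Fin 2)) 1), ?_⟩
  rintro _ ⟨⟨q, hq⟩, rfl⟩
  have hqz : 0 < q ^ ζ := Real.rpow_pos_of_pos hq ζ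
  show (∫ z in {z : EuclideanSpace ℝ (Fin 2) | 1 - q < ‖z‖ ∧ ‖z‖ < 1}, η z) / q ^ ζ ≤ _
  rw [div_le_iff₀ hqz]
  have hsub : {z : EuclideanSpace ℝ (Fin 2) | 1 - q < ‖z‖ ∧ ‖z‖ < 1} ⊆ Metric.ball 0 1 := by
    intro z hz
    simpa using hz.2
  have hfin : volume (Metric.ball (0 : EuclideanSpace ℝ (Fin 2)) 1) < ⊤ :=
    measure_ball_lt_top
  have hb : ∀ z ∈ {z : EuclideanSpace ℝ (Fin 2) | 1 - q < ‖z‖ ∧ ‖z‖ < 1},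
      ‖η z‖ ≤ 2 * c * q ^ ζ := by
    rintro z ⟨h1, h2⟩
    have h0 := norm_nonneg z
    rw [hη, if_pos h2, Real.norm_of_nonneg (by positivity)]
    have hpos : 0 < 1 - ‖z‖ ^ 2 := by nlinarith
    have hexp : Real.exp (1 / (‖z‖ ^ 2 - 1)) ≤ 1 - ‖z‖ ^ 2 := by
      have e : 1 / (‖z‖ ^ 2 - 1) = -(1 - ‖z‖ ^ 2)⁻¹ := by
        rw [← inv_neg, neg_sub, one_div]
      rw [e, Real.exp_neg]
      apply inv_le_of_inv_le₀ hpos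
      linarith [Real.add_one_le_exp (1 - ‖z‖ ^ 2)⁻¹]
    have hk : 1 - ‖z‖ ^ 2 ≤ 2 * q ^ ζ := by
      rcases le_total q 1 with h | h
      · have := Real.rpow_le_rpow_of_exponent_ge hq h hζ1
        rw [Real.rpow_one] at this
        nlinarith
      · have := Real.one_le_rpow h hζ0.le
        nlinarith
    nlinarith
  have h := norm_setIntegral_le_of_norm_le_const (μ := volume)
    ((measure_mono hsub).trans_lt hfin) hb
  have hm := measureReal_mono (μ := volume) hsub hfin.ne
  calc _ ≤ _ := Real.le_norm_self _
    _ ≤ _ := h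
    _ ≤ 2 * c * q ^ ζ * volume.real (Metric.ball (0 : EuclideanSpace ℝ (Fin 2)) 1) := by gcongr
    _ = _ := by ring
end
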